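/- Let μ be a finite Borel measure on ℝ, let θ > 0, let 0 ≤ t ≤ T, and set B(t,T) := (1 − e^{−θ(T−t)})/θ. Then ∫_t^T ( ∫_{[0,t]} e^{−θ(s−u)} · (1/θ)(1 − e^{−θ(s−u)}) dμ(u) ) ds = B(t,T) · ∫_{[0,t]} e^{−θ(t−u)} · (1/θ)(1 − e^{−θ(t−u)}) dμ(u) + (1/2) B(t,T)² · ∫_{[0,t]} e^{−2θ(t−u)} dμ(u). -/

import Mathlib

open MeasureTheory

/-- The second integral identity from Theorem 4.2 (Hull-White term structure): for a
finite Borel measure `μ` on `ℝ`, `θ > 0`, `0 ≤ t ≤ T`, and `B(t,T) = (1 − e^{−θ(T−t)})/θ`,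
`∫_t^T (∫_{[0,t]} e^{−θ(s−u)} (1/θ)(1 − e^{−θ(s−u)}) dμ(u)) ds
  = B(t,T) ∫_{[0,t]} e^{−θ(t−u)} (1/θ)(1 − e^{−θ(t−u)}) dμ(u)
    + (1/2) B(t,T)² ∫_{[0,t]} e^{−2θ(t−u)} dμ(u)`. -/
theorem hull_white_second_integral_identity
    (μ : Measure ℝ) [IsFiniteMeasure μ] (θ : ℝ) (hθ : 0 < θ)
    (t T : ℝ) (h0 : 0 ≤ t) (h1 : t ≤ T) :
    (∫ s in t..T, ∫ u in Set.Icc (0:ℝ) t,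
        Real.exp (-θ * (s - u)) * ((1 / θ) * (1 - Real.exp (-θ * (s - u)))) ∂μ)
      = (1 - Real.exp (-θ * (T - t))) / θ
          * (∫ u in Set.Icc (0:ℝ) t,
              Real.exp (-θ * (t - u)) * ((1 / θ) * (1 - Real.exp (-θ * (t - u)))) ∂μ)
        + (1 / 2) * ((1 - Real.exp (-θ * (T - t))) / θ) ^ 2
          * ∫ u in Set.Icc (0:ℝ) t, Real.exp (-2 * θ * (t - u)) ∂μ := by
  have i1 : Integrable (fun u => Real.exp (-θ * (t - u))) (μ.restrict (Set.Icc (0:ℝ) t)) :=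
    (Continuous.continuousOn (by fun_prop)).integrableOn_compact isCompact_Icc
  have i2 : Integrable (fun u => Real.exp (-2 * θ * (t - u))) (μ.restrict (Set.Icc (0:ℝ) t)) :=
    (Continuous.continuousOn (by fun_prop)).integrableOn_compact isCompact_Icc
  have key : ∀ s : ℝ, (∫ u in Set.Icc (0:ℝ) t,
        Real.exp (-θ * (s - u)) * ((1 / θ) * (1 - Real.exp (-θ * (s - u)))) ∂μ)
      = (1 / θ * Real.exp (-θ * (s - t))) * (∫ u in Set.Icc (0:ℝ) t, Real.exp (-θ * (t - u)) ∂μ)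
        - (1 / θ * Real.exp (-θ * (s - t)) ^ 2)
          * ∫ u in Set.Icc (0:ℝ) t, Real.exp (-2 * θ * (t - u)) ∂μ := by
    intro s
    rw [← integral_const_mul, ← integral_const_mul,
      ← integral_sub (i1.const_mul _) (i2.const_mul _)]
    congr 1
    funext u
    have e1 : Real.exp (-θ * (s - u)) = Real.exp (-θ * (s - t)) * Real.exp (-θ * (t - u)) := by
      rw [← Real.exp_add]; congr 1; ring
    have e2 : Real.exp (-2 * θ * (t - u)) = Real.exp (-θ * (t - u)) ^ 2 := by
      rw [← Real.exp_nat_mul]; congr 1; push_cast; ring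
    rw [e1, e2]; ring
  simp_rw [key]
  generalize (∫ u in Set.Icc (0:ℝ) t, Real.exp (-θ * (t - u)) ∂μ) = I1
  generalize (∫ u in Set.Icc (0:ℝ) t, Real.exp (-2 * θ * (t - u)) ∂μ) = I2
  have hθ' : θ ≠ 0 := hθ.ne'
  have hd : ∀ s ∈ Set.uIcc t T, HasDerivAt
      (fun s => (1 / θ) * (-(Real.exp (-θ * (s - t)) / θ) * I1
        + Real.exp (-θ * (s - t)) ^ 2 / (2 * θ) * I2))
      ((1 / θ * Real.exp (-θ * (s - t))) * I1
        - (1 / θ * Real.exp (-θ * (s - t)) ^ 2) * I2) s := by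
    intro s _
    have h : HasDerivAt (fun s => Real.exp (-θ * (s - t)))
        (Real.exp (-θ * (s - t)) * (-θ * 1)) s :=
      (((hasDerivAt_id s).sub_const t).const_mul (-θ)).exp
    have h2 := ((((h.div_const θ).neg).mul_const I1).add
      (((h.pow 2).div_const (2 * θ)).mul_const I2)).const_mul (1 / θ)
    refine h2.congr_deriv ?_
    field_simp
    push_cast
    ring
  rw [intervalIntegral.integral_eq_sub_of_hasDerivAt hd
    (Continuous.intervalIntegrable (by fun_prop) _ _)]
  simp only [sub_self, mul_zero, Real.exp_zero]
  field_simp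
  ring
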